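/- arXiv:2203.01836 — 2 statements merged into one kernel-verified Lean document; each statement's English description precedes it below -/
import Mathlib

section
/- Let n ≥ 2, let Ω^o be a bounded open subset of ℝ^n with 0 ∈ Ω^o, let S = ∂Ω^o, and assume σ_S is a finite measure. Let ν : ℝ^n → ℝ^n and θ : ℝ^n → ℝ be continuous, let t ∈ ℝ^n, and let k ∈ ℕ. Then the map ε ↦ −∫ ν(y)·∇G_n(ε·t − y)·θ(y) dσ_S(y) is smooth on {ε : |ε|·‖t‖ < dist(0, S)} and its k-th derivative at ε = 0 equals (−1)^k · Σ_{β ∈ ℕ^n, |β| = k} (k!/β!) · t^β · ∫ ν(y)·(∇D^β G_n)(y)·θ(y) dσ_S(y), where · denotes the Euclidean inner product. -/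
open MeasureTheory RealInnerProductSpace Pointwise

/-- The measure `σ_S`: the `(n-1)`-dimensional Hausdorff measure on `ℝⁿ` restricted to `S`. -/
noncomputable def bdryMeasure (n : ℕ) (S : Set (EuclideanSpace ℝ (Fin n))) :
    Measure (EuclideanSpace ℝ (Fin n)) := (μH[(n : ℝ) - 1]).restrict S

/-- `s_n`: the `(n-1)`-dimensional Hausdorff measure of the unit sphere of `ℝⁿ`. -/
noncomputable def sphereArea (n : ℕ) : ℝ :=
  (μH[(n : ℝ) - 1] (Metric.sphere (0 : EuclideanSpace ℝ (Fin n)) 1)).toReal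

/-- The fundamental solution `G_n` of `-Δ` in `ℝⁿ`. -/
noncomputable def fundSol (n : ℕ) (x : EuclideanSpace ℝ (Fin n)) : ℝ :=
  if n = 2 then -(1 / (2 * Real.pi)) * Real.log ‖x‖
  else (1 / (((n : ℝ) - 2) * sphereArea n)) * ‖x‖ ^ ((2 : ℝ) - (n : ℝ))

/-- The partial derivative in the `i`-th coordinate direction. -/
noncomputable def pderiv' {n : ℕ} (i : Fin n) (F : EuclideanSpace ℝ (Fin n) → ℝ) :
    EuclideanSpace ℝ (Fin n) → ℝ :=
  fun x => lineDeriv ℝ F x (EuclideanSpace.single i 1)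

/-- The iterated partial derivative `D^β F` of multi-index `β`. -/
noncomputable def multiDeriv {n : ℕ} (β : Fin n → ℕ) (F : EuclideanSpace ℝ (Fin n) → ℝ) :
    EuclideanSpace ℝ (Fin n) → ℝ :=
  (List.finRange n).foldr (fun i G => (pderiv' i)^[β i] G) F


open scoped ContDiff Topology

section Helpers

variable {E : Type*} [NormedAddCommGroup E] [NormedSpace ℝ E]

/-- Functions smooth away from the origin, normalised to vanish at the origin. -/
def SmoothOff (E : Type*) [NormedAddCommGroup E] [NormedSpace ℝ E] : Submodule ℝ (E → ℝ) where
  carrier := {f | ContDiffOn ℝ ∞ f {0}ᶜ ∧ f 0 = 0}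
  add_mem' := by
    rintro f g ⟨hf, hf0⟩ ⟨hg, hg0⟩
    exact ⟨hf.add hg, by simp [hf0, hg0]⟩
  zero_mem' := ⟨contDiffOn_const, rfl⟩
  smul_mem' := by
    rintro c f ⟨hf, hf0⟩
    exact ⟨hf.const_smul c, by simp [hf0]⟩

lemma SmoothOff.contDiffAt (f : SmoothOff E) {x : E} (hx : x ≠ 0) :
    ContDiffAt ℝ ∞ (f : E → ℝ) x :=
  f.2.1.contDiffAt (isOpen_compl_singleton.mem_nhds hx)

lemma SmoothOff.differentiableAt (f : SmoothOff E) {x : E} (hx : x ≠ 0) :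
    DifferentiableAt ℝ (f : E → ℝ) x :=
  (SmoothOff.contDiffAt f hx).differentiableAt (by simp)

open Classical in
/-- Directional derivative as an endomorphism. -/
noncomputable def dirD (v : E) : Module.End ℝ (SmoothOff E) where
  toFun f := ⟨fun x => if x = 0 then 0 else fderiv ℝ (f : E → ℝ) x v, by
    refine ⟨?_, by simp⟩
    have h1 : ContDiffOn ℝ ∞ (fun x => fderiv ℝ (f : E → ℝ) x v) {0}ᶜ :=
      (f.2.1.fderiv_of_isOpen isOpen_compl_singleton (by simp)).clm_apply contDiffOn_const
    exact h1.congr fun x hx => if_neg hx⟩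
  map_add' f g := by
    ext x
    by_cases hx : x = 0
    · simp [hx]
    · simp [hx, fderiv_add (SmoothOff.differentiableAt f hx) (SmoothOff.differentiableAt g hx)]
  map_smul' c f := by
    ext x
    by_cases hx : x = 0
    · simp [hx]
    · simp [hx, fderiv_const_smul (SmoothOff.differentiableAt f hx)]

lemma dirD_apply (v : E) (f : SmoothOff E) {x : E} (hx : x ≠ 0) :
    (dirD v f : E → ℝ) x = fderiv ℝ (f : E → ℝ) x v := if_neg hx

lemma SmoothOff.ext' {f g : SmoothOff E} (h : ∀ x ≠ 0, (f : E → ℝ) x = (g : E → ℝ) x) :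
    f = g := by
  ext x
  by_cases hx : x = 0
  · rw [hx, f.2.2, g.2.2]
  · exact h x hx

lemma dirD_eventuallyEq (v : E) (f : SmoothOff E) {x : E} (hx : x ≠ 0) :
    (dirD v f : E → ℝ) =ᶠ[𝓝 x] fun x => fderiv ℝ (f : E → ℝ) x v := by
  filter_upwards [isOpen_compl_singleton.mem_nhds hx] with y hy using dirD_apply v f hy

lemma SmoothOff.differentiableAt_fderiv (f : SmoothOff E) {x : E} (hx : x ≠ 0) :
    DifferentiableAt ℝ (fderiv ℝ (f : E → ℝ)) x :=
  ((SmoothOff.contDiffAt f hx).fderiv_right (m := 1) (by norm_cast)).differentiableAt (by simp)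

lemma fderiv_dirD (v w : E) (f : SmoothOff E) {x : E} (hx : x ≠ 0) :
    fderiv ℝ (dirD v f : E → ℝ) x w = fderiv ℝ (fderiv ℝ (f : E → ℝ)) x w v := by
  rw [(dirD_eventuallyEq v f hx).fderiv_eq,
    fderiv_clm_apply (SmoothOff.differentiableAt_fderiv f hx) (differentiableAt_const v)]
  simp

lemma fderiv_dirD_comm (v w : E) (f : SmoothOff E) {x : E} (hx : x ≠ 0) :
    fderiv ℝ (dirD v f : E → ℝ) x w = fderiv ℝ (dirD w f : E → ℝ) x v := by
  rw [fderiv_dirD v w f hx, fderiv_dirD w v f hx]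
  exact ((SmoothOff.contDiffAt f hx).isSymmSndFDerivAt (by simp; norm_cast)) w v

lemma dirD_commute (v w : E) : Commute (dirD v) (dirD w) := by
  apply LinearMap.ext
  intro f
  apply SmoothOff.ext'
  intro x hx
  show (dirD v (dirD w f) : E → ℝ) x = (dirD w (dirD v f) : E → ℝ) x
  rw [dirD_apply _ _ hx, dirD_apply _ _ hx, fderiv_dirD_comm w v f hx]

lemma dirD_sum {ι : Type*} (s : Finset ι) (c : ι → ℝ) (e : ι → E) :
    dirD (∑ i ∈ s, c i • e i) = ∑ i ∈ s, c i • dirD (e i) := by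
  apply LinearMap.ext
  intro f
  apply SmoothOff.ext'
  intro x hx
  rw [dirD_apply _ _ hx, map_sum]
  simp only [LinearMap.sum_apply, Submodule.coe_sum, Finset.sum_apply, LinearMap.smul_apply,
    Submodule.coe_smul, Pi.smul_apply, map_smul, dirD_apply _ _ hx]

lemma dirD_neg (v : E) (f : SmoothOff E) (c : ℝ) (h : ∀ x, (f : E → ℝ) (-x) = c * (f : E → ℝ) x)
    (x : E) (hx : x ≠ 0) :
    fderiv ℝ (f : E → ℝ) (-x) v = -c * fderiv ℝ (f : E → ℝ) x v := by
  have h1 : (fun x => (f : E → ℝ) (-x)) = fun x => c * (f : E → ℝ) x := funext h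
  have h2 := congrArg (fun g => fderiv ℝ g x v) h1
  have h3 : HasFDerivAt (fun x => (f : E → ℝ) (-x))
      ((fderiv ℝ (f : E → ℝ) (-x)).comp (-ContinuousLinearMap.id ℝ E)) x :=
    (SmoothOff.differentiableAt f (neg_ne_zero.2 hx)).hasFDerivAt.comp x (hasFDerivAt_id x).neg
  simp only [h3.fderiv, fderiv_const_mul (SmoothOff.differentiableAt f hx)] at h2
  simp at h2
  linarith

lemma dirD_pow_neg (v : E) (f : SmoothOff E) (h : ∀ x, (f : E → ℝ) (-x) = (f : E → ℝ) x) (k : ℕ) :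
    ∀ x, (((dirD v) ^ k) f : E → ℝ) (-x) = (-1) ^ k * (((dirD v) ^ k) f : E → ℝ) x := by
  induction k with
  | zero => simpa using h
  | succ k ih =>
    intro x
    rw [pow_succ' (dirD v)]
    show (dirD v (((dirD v) ^ k) f) : E → ℝ) (-x) = _ * (dirD v (((dirD v) ^ k) f) : E → ℝ) x
    by_cases hx : x = 0
    · have := (dirD v (((dirD v) ^ k) f)).2.2
      simp [hx, this]
    · rw [dirD_apply _ _ hx, dirD_apply _ _ (neg_ne_zero.2 hx), dirD_neg v _ _ ih x hx]
      ring

variable [MeasurableSpace E] [BorelSpace E]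

lemma integrable_of_compact (μ : Measure E) (K : Set E) (hK : IsCompact K)
    [IsFiniteMeasure (μ.restrict K)] (f : E → ℝ) (hf : ContinuousOn f K) :
    Integrable f (μ.restrict K) := by
  obtain ⟨C, hC⟩ := hK.exists_bound_of_continuousOn hf
  refine Integrable.of_bound (hf.aestronglyMeasurable hK.measurableSet) C ?_
  filter_upwards [ae_restrict_mem hK.measurableSet] with y hy using hC y hy

/-- The parametric integral. -/
noncomputable def pint (μ : Measure E) (ν : E → E) (θ : E → ℝ) (t : E) (f : SmoothOff E)
    (ε : ℝ) : ℝ :=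
  ∫ y, fderiv ℝ (f : E → ℝ) (ε • t - y) (ν y) * θ y ∂μ

lemma cont_integrand (K : Set E) (ν : E → E) (hν : Continuous ν)
    (θ : E → ℝ) (hθ : Continuous θ) (t : E) (f : SmoothOff E) (U : Set ℝ)
    (hUK : ∀ ε ∈ U, ∀ y ∈ K, ε • t - y ≠ 0) :
    ContinuousOn (fun p : ℝ × E => fderiv ℝ (f : E → ℝ) (p.1 • t - p.2) (ν p.2) * θ p.2)
      (U ×ˢ K) := by
  have h1 : ContinuousOn (fderiv ℝ (f : E → ℝ)) {0}ᶜ :=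
    f.2.1.continuousOn_fderiv_of_isOpen isOpen_compl_singleton (by simp)
  have h2 : ContinuousOn (fun p : ℝ × E => p.1 • t - p.2) (U ×ˢ K) := by fun_prop
  have h3 := h1.comp h2 (fun p hp => hUK p.1 hp.1 p.2 hp.2)
  exact (h3.clm_apply (by fun_prop)).mul (by fun_prop)

lemma pint_hasDerivAt (μ : Measure E) (K : Set E) (hK : IsCompact K)
    [IsFiniteMeasure (μ.restrict K)] (ν : E → E) (hν : Continuous ν)
    (θ : E → ℝ) (hθ : Continuous θ) (t : E) (f : SmoothOff E) (U : Set ℝ) (hU : IsOpen U)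
    (hUK : ∀ ε ∈ U, ∀ y ∈ K, ε • t - y ≠ 0) (ε : ℝ) (hε : ε ∈ U) :
    HasDerivAt (pint (μ.restrict K) ν θ t f) (pint (μ.restrict K) ν θ t (dirD t f) ε) ε := by
  obtain ⟨r, hr, hrU⟩ := Metric.nhds_basis_closedBall.mem_iff.1 (hU.mem_nhds hε)
  have hc := cont_integrand K ν hν θ hθ t f U hUK
  have hc' := cont_integrand K ν hν θ hθ t (dirD t f) U hUK
  have hint : ∀ g : SmoothOff E, ∀ e ∈ U,
      Integrable (fun y => fderiv ℝ (g : E → ℝ) (e • t - y) (ν y) * θ y) (μ.restrict K) := by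
    intro g e he
    refine integrable_of_compact μ K hK _ ?_
    exact (cont_integrand K ν hν θ hθ t g U hUK).comp (f := fun y => ((e, y) : ℝ × E))
      (by fun_prop) (fun y hy => ⟨he, hy⟩)
  obtain ⟨C, hC⟩ := ((isCompact_closedBall ε r).prod hK).exists_bound_of_continuousOn
    (hc'.mono (Set.prod_mono hrU le_rfl))
  refine (hasDerivAt_integral_of_dominated_loc_of_deriv_le
    (F := fun e y => fderiv ℝ (f : E → ℝ) (e • t - y) (ν y) * θ y)
    (F' := fun e y => fderiv ℝ (dirD t f : E → ℝ) (e • t - y) (ν y) * θ y)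
    (bound := fun _ => C) (Metric.closedBall_mem_nhds ε hr) ?_ (hint f ε hε)
    (hint _ ε hε).aestronglyMeasurable ?_ (integrable_const C) ?_).2
  · filter_upwards [hU.mem_nhds hε] with e he using (hint f e he).aestronglyMeasurable
  · filter_upwards [ae_restrict_mem hK.measurableSet] with y hy e he
    exact hC (e, y) ⟨he, hy⟩
  · filter_upwards [ae_restrict_mem hK.measurableSet] with y hy e he
    have hne := hUK e (hrU he) y hy
    rw [fderiv_dirD _ _ _ hne,
      (SmoothOff.contDiffAt f hne).isSymmSndFDerivAt (by simp; norm_cast) (ν y) t]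
    have h1 : HasDerivAt (fun e : ℝ => e • t - y) t e := by
      simpa using ((hasDerivAt_id e).smul_const t).sub_const y
    have h2 := (SmoothOff.differentiableAt_fderiv f hne).hasFDerivAt.comp_hasDerivAt e h1
    exact (h2.clm_apply (hasDerivAt_const e (ν y))).mul_const (θ y) |>.congr_deriv (by simp)

lemma pint_contDiffOn (μ : Measure E) (K : Set E) (hK : IsCompact K)
    [IsFiniteMeasure (μ.restrict K)] (ν : E → E) (hν : Continuous ν)
    (θ : E → ℝ) (hθ : Continuous θ) (t : E) (U : Set ℝ) (hU : IsOpen U)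
    (hUK : ∀ ε ∈ U, ∀ y ∈ K, ε • t - y ≠ 0) (m : ℕ) (f : SmoothOff E) :
    ContDiffOn ℝ m (pint (μ.restrict K) ν θ t f) U := by
  have hd := fun f => pint_hasDerivAt μ K hK ν hν θ hθ t f U hU hUK
  induction m generalizing f with
  | zero =>
    simp only [Nat.cast_zero, contDiffOn_zero]
    exact fun e he => (hd f e he).continuousAt.continuousWithinAt
  | succ m ih =>
    push_cast
    rw [contDiffOn_succ_iff_deriv_of_isOpen hU]
    refine ⟨fun e he => (hd f e he).differentiableAt.differentiableWithinAt, by simp, ?_⟩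
    exact (ih (dirD t f)).congr fun e he => (hd f e he).deriv

lemma pint_iteratedDeriv (μ : Measure E) (K : Set E) (hK : IsCompact K)
    [IsFiniteMeasure (μ.restrict K)] (ν : E → E) (hν : Continuous ν)
    (θ : E → ℝ) (hθ : Continuous θ) (t : E) (U : Set ℝ) (hU : IsOpen U)
    (hUK : ∀ ε ∈ U, ∀ y ∈ K, ε • t - y ≠ 0) (f : SmoothOff E) (k : ℕ) :
    ∀ ε ∈ U, iteratedDeriv k (pint (μ.restrict K) ν θ t f) ε =
      pint (μ.restrict K) ν θ t (((dirD t) ^ k) f) ε := by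
  induction k with
  | zero => simp
  | succ k ih =>
    intro ε hε
    have h1 : iteratedDeriv k (pint (μ.restrict K) ν θ t f) =ᶠ[𝓝 ε]
        pint (μ.restrict K) ν θ t (((dirD t) ^ k) f) := by
      filter_upwards [hU.mem_nhds hε] with e he using ih e he
    rw [iteratedDeriv_succ, h1.deriv_eq,
      (pint_hasDerivAt μ K hK ν hν θ hθ t _ U hU hUK ε hε).deriv, pow_succ']
    rfl

end Helpers

section Euclid

variable {n : ℕ}

lemma fundSol_contDiffOn : ContDiffOn ℝ ∞ (fundSol n) {0}ᶜ := by
  intro x hx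
  apply ContDiffAt.contDiffWithinAt
  have hx' : x ≠ 0 := hx
  have hn : ‖x‖ ≠ 0 := norm_ne_zero_iff.2 hx'
  have hN : ContDiffAt ℝ ∞ (fun x : EuclideanSpace ℝ (Fin n) => ‖x‖) x := contDiffAt_norm ℝ hx'
  unfold fundSol
  by_cases h : n = 2
  · simp only [h, if_true]
    subst h
    exact contDiffAt_const.mul (hN.log hn)
  · simp only [h, if_false]
    exact contDiffAt_const.mul (hN.rpow_const_of_ne hn)

open Classical in
/-- The fundamental solution as an element of `SmoothOff`. -/
noncomputable def fundSol0 (n : ℕ) : SmoothOff (EuclideanSpace ℝ (Fin n)) :=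
  ⟨fun x => if x = 0 then 0 else fundSol n x,
    fundSol_contDiffOn.congr fun _ hx => if_neg hx, if_pos rfl⟩

lemma fundSol0_apply {x : EuclideanSpace ℝ (Fin n)} (hx : x ≠ 0) :
    (fundSol0 n : EuclideanSpace ℝ (Fin n) → ℝ) x = fundSol n x := if_neg hx

lemma fundSol0_even (x : EuclideanSpace ℝ (Fin n)) :
    (fundSol0 n : EuclideanSpace ℝ (Fin n) → ℝ) (-x) =
      (fundSol0 n : EuclideanSpace ℝ (Fin n) → ℝ) x := by
  by_cases hx : x = 0
  · simp [hx]
  · rw [fundSol0_apply hx, fundSol0_apply (neg_ne_zero.2 hx)]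
    simp [fundSol]

lemma pderiv'_eq (i : Fin n) (F : EuclideanSpace ℝ (Fin n) → ℝ)
    (f : SmoothOff (EuclideanSpace ℝ (Fin n)))
    (h : ∀ x ≠ 0, F x = (f : EuclideanSpace ℝ (Fin n) → ℝ) x) :
    ∀ x ≠ 0, pderiv' i F x =
      (dirD (EuclideanSpace.single i (1 : ℝ)) f : EuclideanSpace ℝ (Fin n) → ℝ) x := by
  intro x hx
  have h1 : F =ᶠ[𝓝 x] (f : EuclideanSpace ℝ (Fin n) → ℝ) := by
    filter_upwards [isOpen_compl_singleton.mem_nhds hx] with y hy using h y hy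
  rw [dirD_apply _ _ hx, pderiv', h1.lineDeriv_eq]
  exact (SmoothOff.differentiableAt f hx).lineDeriv_eq_fderiv

lemma pderiv'_iterate_eq (i : Fin n) (m : ℕ) (F : EuclideanSpace ℝ (Fin n) → ℝ)
    (f : SmoothOff (EuclideanSpace ℝ (Fin n)))
    (h : ∀ x ≠ 0, F x = (f : EuclideanSpace ℝ (Fin n) → ℝ) x) :
    ∀ x ≠ 0, (pderiv' i)^[m] F x =
      (((dirD (EuclideanSpace.single i (1 : ℝ))) ^ m) f : EuclideanSpace ℝ (Fin n) → ℝ) x := by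
  induction m with
  | zero => simpa using h
  | succ m ih =>
    rw [Function.iterate_succ_apply', pow_succ']
    exact pderiv'_eq i _ _ ih

lemma foldr_eq (β : Fin n → ℕ) (l : List (Fin n)) :
    ∀ x ≠ 0, l.foldr (fun i G => (pderiv' i)^[β i] G) (fundSol n) x =
      ((l.map fun i => (dirD (EuclideanSpace.single i (1 : ℝ))) ^ β i).prod (fundSol0 n) :
        EuclideanSpace ℝ (Fin n) → ℝ) x := by
  induction l with
  | nil => intro x hx; simpa using (fundSol0_apply hx).symm
  | cons i l ih =>
    rw [List.map_cons, List.prod_cons]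
    exact pderiv'_iterate_eq i (β i) _ _ ih

/-- `D^β G_n` as an element of `SmoothOff`. -/
noncomputable def mD (β : Fin n → ℕ) : SmoothOff (EuclideanSpace ℝ (Fin n)) :=
  ((List.finRange n).map fun i => (dirD (EuclideanSpace.single i (1 : ℝ))) ^ β i).prod (fundSol0 n)

lemma multiDeriv_eq (β : Fin n → ℕ) : ∀ x ≠ 0, multiDeriv β (fundSol n) x =
    (mD β : EuclideanSpace ℝ (Fin n) → ℝ) x := foldr_eq β _

lemma prod_map_smul_pow {A : Type*} [Ring A] [Algebra ℝ A] {ι : Type*} (l : List ι) (c : ι → ℝ)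
    (d : ι → A) (β : ι → ℕ) :
    (l.map fun i => (c i • d i) ^ β i).prod =
      (l.map fun i => c i ^ β i).prod • (l.map fun i => d i ^ β i).prod := by
  induction l with
  | nil => simp
  | cons i l ih =>
    simp only [List.map_cons, List.prod_cons]
    rw [ih, smul_pow, smul_mul_smul_comm]

lemma dirD_pow_eq (t : EuclideanSpace ℝ (Fin n)) (k : ℕ) :
    ((dirD t) ^ k) (fundSol0 n) = ∑ β ∈ Finset.Nat.antidiagonalTuple n k,
        (((k.factorial : ℝ) / ∏ i, ((β i).factorial : ℝ)) * (∏ i, t i ^ β i)) • mD β := by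
  have ht : t = ∑ i, t i • EuclideanSpace.single i (1 : ℝ) := by
    ext j
    simp [Finset.sum_apply, Pi.single_apply]
  have hA : Finset.Nat.antidiagonalTuple n k = Finset.piAntidiag Finset.univ k := by
    ext β; simp [Finset.Nat.mem_antidiagonalTuple]
  conv_lhs => rw [ht]
  rw [dirD_sum, Finset.sum_pow_eq_sum_piAntidiag_of_commute _ _
    (fun i _ j _ _ => ((dirD_commute _ _).smul_left _).smul_right _), LinearMap.sum_apply, hA]
  refine Finset.sum_congr rfl fun β hβ => ?_
  have hsum : ∑ i, β i = k := (Finset.mem_piAntidiag.1 hβ).1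
  have hp : ∀ comm, Finset.univ.noncommProd
      (fun i => (t i • dirD (EuclideanSpace.single i (1 : ℝ))) ^ β i) comm =
      (∏ i, t i ^ β i) •
        ((List.finRange n).map fun i => (dirD (EuclideanSpace.single i (1 : ℝ))) ^ β i).prod := by
    intro comm
    have h1 : (Finset.univ : Finset (Fin n)) = (List.finRange n).toFinset := by simp
    refine (Finset.noncommProd_congr h1 (fun _ _ => rfl) comm).trans ?_
    refine (Finset.noncommProd_toFinset _ _ _ (List.nodup_finRange n)).trans ?_
    refine (prod_map_smul_pow (List.finRange n) (fun i => t i)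
      (fun i => dirD (EuclideanSpace.single i (1 : ℝ))) β).trans ?_
    rw [← List.ofFn_eq_map, List.prod_ofFn]
  rw [hp]
  have hm : ((Nat.multinomial Finset.univ β : ℕ) : ℝ) =
      (k.factorial : ℝ) / ∏ i, ((β i).factorial : ℝ) := by
    rw [eq_div_iff (Finset.prod_ne_zero_iff.2 fun i _ => by positivity), mul_comm, ← hsum]
    exact_mod_cast Nat.multinomial_spec Finset.univ β
  rw [← hm, mul_smul, Nat.cast_smul_eq_nsmul, ← nsmul_eq_mul]
  rfl

end Euclid

/-- The map `ε ↦ -∫_{∂Ωᵒ} ν(y) · ∇G_n(ε•t - y) θ(y) dσ(y)` is smooth on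
`{ε : |ε| · ‖t‖ < dist(0, ∂Ωᵒ)}` and its `k`-th derivative at `ε = 0` is
`(-1)^k ∑_{|β|=k} (k!/β!) t^β ∫_{∂Ωᵒ} ν(y) · (∇D^β G_n)(y) θ(y) dσ(y)`. -/
theorem stmt10 (n : ℕ) (hn : 2 ≤ n) (Ωo : Set (EuclideanSpace ℝ (Fin n)))
    (hΩ : IsOpen Ωo) (hb : Bornology.IsBounded Ωo) (h0 : (0 : EuclideanSpace ℝ (Fin n)) ∈ Ωo)
    (hfin : IsFiniteMeasure (bdryMeasure n (frontier Ωo)))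
    (ν : EuclideanSpace ℝ (Fin n) → EuclideanSpace ℝ (Fin n)) (hν : Continuous ν)
    (θ : EuclideanSpace ℝ (Fin n) → ℝ) (hθ : Continuous θ)
    (t : EuclideanSpace ℝ (Fin n)) (k : ℕ) :
    ContDiffOn ℝ (⊤ : ℕ∞)
        (fun ε : ℝ => -∫ y, ⟪ν y, gradient (fundSol n) (ε • t - y)⟫ * θ y
          ∂(bdryMeasure n (frontier Ωo)))
        {ε : ℝ | |ε| * ‖t‖ < Metric.infDist (0 : EuclideanSpace ℝ (Fin n)) (frontier Ωo)} ∧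
    iteratedDeriv k
        (fun ε : ℝ => -∫ y, ⟪ν y, gradient (fundSol n) (ε • t - y)⟫ * θ y
          ∂(bdryMeasure n (frontier Ωo))) 0 =
      (-1 : ℝ) ^ k * ∑ β ∈ Finset.Nat.antidiagonalTuple n k,
        ((k.factorial : ℝ) / ∏ i, ((β i).factorial : ℝ)) * (∏ i, t i ^ β i) *
          ∫ y, ⟪ν y, gradient (multiDeriv β (fundSol n)) y⟫ * θ y
            ∂(bdryMeasure n (frontier Ωo)) := by
  set K := frontier Ωo with hKdef
  have hK : IsCompact K := Metric.isCompact_of_isClosed_isBounded isClosed_frontier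
    (hb.closure.subset frontier_subset_closure)
  have h0K : (0 : EuclideanSpace ℝ (Fin n)) ∉ K := fun h => by
    rw [hKdef, hΩ.frontier_eq] at h
    exact h.2 h0
  have : IsFiniteMeasure ((μH[(n : ℝ) - 1] : Measure (EuclideanSpace ℝ (Fin n))).restrict K) :=
    hfin
  have hU0 : IsOpen {ε : ℝ | |ε| * ‖t‖ < Metric.infDist (0 : EuclideanSpace ℝ (Fin n)) K} :=
    isOpen_lt (by fun_prop) continuous_const
  have hUK0 : ∀ ε ∈ {ε : ℝ | |ε| * ‖t‖ < Metric.infDist (0 : EuclideanSpace ℝ (Fin n)) K},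
      ∀ y ∈ K, ε • t - y ≠ 0 := by
    intro ε hε y hy h
    have h1 : Metric.infDist (0 : EuclideanSpace ℝ (Fin n)) K ≤ ‖y‖ := by
      simpa using Metric.infDist_le_dist_of_mem (x := (0 : EuclideanSpace ℝ (Fin n))) hy
    rw [← sub_eq_zero.1 h, norm_smul, Real.norm_eq_abs] at h1
    exact absurd hε (not_lt.2 h1)
  -- a (possibly smaller or larger) open set around zero
  let U : Set ℝ := {ε | ∀ y ∈ K, ε • t - y ≠ 0}
  have hU : IsOpen U := by
    have : U = (fun ε : ℝ => ε • t) ⁻¹' Kᶜ := by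
      ext ε
      simp only [U, Set.mem_ofPred_eq, Set.mem_preimage, Set.mem_compl_iff, sub_ne_zero]
      exact ⟨fun h hm => h _ hm rfl, fun h y hy he => h (he ▸ hy)⟩
    rw [this]
    exact hK.isClosed.isOpen_compl.preimage (by fun_prop)
  have hUK : ∀ ε ∈ U, ∀ y ∈ K, ε • t - y ≠ 0 := fun ε h => h
  have h0U : (0 : ℝ) ∈ U := fun y hy h => h0K (by simpa using (by simpa using h : y = 0) ▸ hy)
  have hgrad : ∀ (F : EuclideanSpace ℝ (Fin n) → ℝ) (f : SmoothOff (EuclideanSpace ℝ (Fin n))),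
      (∀ x ≠ 0, F x = (f : EuclideanSpace ℝ (Fin n) → ℝ) x) → ∀ x ≠ 0, ∀ v,
      ⟪v, gradient F x⟫ = fderiv ℝ (f : EuclideanSpace ℝ (Fin n) → ℝ) x v := by
    intro F f h x hx v
    have h1 : F =ᶠ[𝓝 x] (f : EuclideanSpace ℝ (Fin n) → ℝ) := by
      filter_upwards [isOpen_compl_singleton.mem_nhds hx] with y hy using h y hy
    rw [inner_gradient_right, h1.fderiv_eq]
    simp
  have hF : ∀ ε ∈ U, (-∫ y, ⟪ν y, gradient (fundSol n) (ε • t - y)⟫ * θ y ∂(bdryMeasure n K)) =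
      -pint ((μH[(n : ℝ) - 1]).restrict K) ν θ t (fundSol0 n) ε := by
    intro ε hε
    unfold pint bdryMeasure
    congr 1
    refine setIntegral_congr_fun hK.measurableSet fun y hy => ?_
    beta_reduce
    rw [hgrad _ (fundSol0 n) (fun x hx => (fundSol0_apply hx).symm) _ (hε y hy)]
  constructor
  · refine ContDiffOn.congr (f := fun ε => -pint ((μH[(n : ℝ) - 1]).restrict K) ν θ t
      (fundSol0 n) ε) ?_ fun ε hε => hF ε (hUK0 ε hε)
    refine ContDiffOn.neg ?_
    rw [contDiffOn_infty]
    exact fun m => pint_contDiffOn _ K hK ν hν θ hθ t _ hU0 hUK0 m _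
  · have hev : (fun ε : ℝ => -∫ y, ⟪ν y, gradient (fundSol n) (ε • t - y)⟫ * θ y
        ∂(bdryMeasure n K)) =ᶠ[𝓝 0]
        -(pint ((μH[(n : ℝ) - 1]).restrict K) ν θ t (fundSol0 n)) := by
      filter_upwards [hU.mem_nhds h0U] with ε hε using hF ε hε
    rw [hev.iteratedDeriv_eq, iteratedDeriv_neg,
      pint_iteratedDeriv _ K hK ν hν θ hθ t U hU hUK _ k 0 h0U]
    have hint : ∀ β : Fin n → ℕ, ∫ y, ⟪ν y, gradient (multiDeriv β (fundSol n)) y⟫ * θ y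
        ∂(bdryMeasure n K) = ∫ y in K, fderiv ℝ (mD β : EuclideanSpace ℝ (Fin n) → ℝ) y (ν y) * θ y
          ∂μH[(n : ℝ) - 1] := by
      intro β
      refine setIntegral_congr_fun hK.measurableSet fun y hy => ?_
      beta_reduce
      rw [hgrad _ (mD β) (multiDeriv_eq β) y (fun h => h0K (h ▸ hy))]
    have hI : ∀ β : Fin n → ℕ, Integrable (fun y =>
        fderiv ℝ (mD β : EuclideanSpace ℝ (Fin n) → ℝ) y (ν y) * θ y)
        ((μH[(n : ℝ) - 1]).restrict K) := by
      intro β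
      refine integrable_of_compact _ K hK _ ?_
      have h1 : ContinuousOn (fderiv ℝ (mD β : EuclideanSpace ℝ (Fin n) → ℝ)) {0}ᶜ :=
        (mD β).2.1.continuousOn_fderiv_of_isOpen isOpen_compl_singleton (by simp)
      have h2 := h1.mono (fun y hy (h : y = 0) => h0K (h ▸ hy) : K ⊆ {0}ᶜ)
      exact (h2.clm_apply hν.continuousOn).mul hθ.continuousOn
    simp only [hint]
    simp only [← integral_const_mul]
    rw [← integral_finsetSum _ (fun β _ => (hI β).const_mul _), ← integral_const_mul, pint,
      ← integral_neg]
    refine setIntegral_congr_fun hK.measurableSet fun y hy => ?_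
    have hy0 : y ≠ 0 := fun h => h0K (h ▸ hy)
    simp only [zero_smul, zero_sub]
    rw [dirD_neg (ν y) _ _ (dirD_pow_neg t (fundSol0 n) fundSol0_even k) y hy0, dirD_pow_eq]
    rw [Submodule.coe_sum, fderiv_sum
      (fun β _ => SmoothOff.differentiableAt _ hy0)]
    simp only [Submodule.coe_smul, fderiv_const_smul (SmoothOff.differentiableAt (mD _) hy0)]
    simp only [ContinuousLinearMap.sum_apply, ContinuousLinearMap.smul_apply, smul_eq_mul]
    rw [neg_mul, neg_mul, neg_neg, mul_assoc, Finset.sum_mul]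
    simp only [mul_assoc]
end

section
/- Let n ≥ 2, let Ω^o be a bounded open subset of ℝ^n with 0 ∈ Ω^o, let S = ∂Ω^o, and assume σ_S is a finite measure. Let ν : ℝ^n → ℝ^n and θ : ℝ^n → ℝ be continuous, let v ∈ ℝ^n be a fixed vector, let t₀ ∈ ℝ^n, and let k ∈ ℕ. For ε with |ε|·‖t₀‖ < dist(0, S), define F(ε) = −v · ∇_t [ t ↦ ∫ ν(y)·∇G_n(ε·t − y)·θ(y) dσ_S(y) ](t₀), the negative of the directional derivative along v, at t₀, of the inner integral as a function of t. Then the k-th derivative of F at ε = 0 equals (−1)^k · Σ_{β ∈ ℕ^n, |β| = k} (k!/β!) · (v·∇p_β(t₀)) · ∫ ν(y)·(∇D^β G_n)(y)·θ(y) dσ_S(y), where p_β(t) = t^β is the monomial of multi-index β and · denotes the Euclidean inner product. -/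
open MeasureTheory RealInnerProductSpace Pointwise

section Alg

lemma alg_comm {R : Type*} [CommRing R] [Algebra ℝ R] {n : ℕ} (X : Fin n → R) (ℓ : R →ₗ[ℝ] ℝ)
    (t v : EuclideanSpace ℝ (Fin n)) (k : ℕ) :
    (k : ℝ) * ℓ ((∑ i, t i • X i) ^ (k - 1) * (∑ i, v i • X i)) =
      ∑ β ∈ Finset.Nat.antidiagonalTuple n k,
        ((k.factorial : ℝ) / ∏ i, ((β i).factorial : ℝ)) *
          lineDeriv ℝ (fun t : EuclideanSpace ℝ (Fin n) => ∏ i, t i ^ β i) t v *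
          ℓ (∏ i, X i ^ β i) := by
  set a := ∑ i, t i • X i with ha
  set b := ∑ i, v i • X i with hb
  have hab : ∀ τ : ℝ, (∑ i, (t + τ • v) i • X i) = τ • b + a := by
    intro τ
    simp [ha, hb, Finset.smul_sum, ← Finset.sum_add_distrib, add_smul, mul_smul, add_comm]
  have h1 : ∀ τ : ℝ, ℓ ((∑ i, (t + τ • v) i • X i) ^ k) =
      ∑ β ∈ Finset.Nat.antidiagonalTuple n k,
        ((k.factorial : ℝ) / ∏ i, ((β i).factorial : ℝ)) * (∏ i, (t + τ • v) i ^ β i) *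
          ℓ (∏ i, X i ^ β i) := by
    intro τ
    rw [Finset.sum_pow_eq_sum_piAntidiag, Finset.piAntidiag_univ_fin_eq_antidiagonalTuple, map_sum]
    refine Finset.sum_congr rfl fun β hβ => ?_
    have hs : ∑ i, β i = k := Finset.Nat.mem_antidiagonalTuple.1 hβ
    have hm := Nat.multinomial_spec Finset.univ β
    rw [hs] at hm
    have hm' : (Nat.multinomial Finset.univ β : ℝ) =
        (k.factorial : ℝ) / ∏ i, ((β i).factorial : ℝ) := by
      rw [eq_div_iff (by positivity), ← hm]; push_cast; ring
    rw [← hm']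
    simp only [smul_pow]
    rw [Finset.prod_smul, ← nsmul_eq_mul, map_nsmul, map_smul]
    simp [mul_assoc]
  have h2 : ∀ τ : ℝ, ℓ ((τ • b + a) ^ k) =
      ∑ m ∈ Finset.range (k + 1), τ ^ m * ((k.choose m : ℝ) * ℓ (a ^ (k - m) * b ^ m)) := by
    intro τ
    rw [add_pow, map_sum]
    refine Finset.sum_congr rfl fun m hm => ?_
    have : (τ • b) ^ m * a ^ (k - m) * (k.choose m : R) =
        τ ^ m • ((k.choose m) • (a ^ (k - m) * b ^ m)) := by
      rw [smul_pow, nsmul_eq_mul]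
      simp only [smul_mul_assoc]
      congr 1; ring
    rw [this, map_smul, map_nsmul]
    simp
  have d2 : HasDerivAt (fun τ : ℝ => ℓ ((∑ i, (t + τ • v) i • X i) ^ k))
      ((k : ℝ) * ℓ (a ^ (k - 1) * b)) 0 := by
    simp only [hab, h2]
    have : HasDerivAt (fun τ : ℝ => ∑ m ∈ Finset.range (k + 1), τ ^ m *
        ((k.choose m : ℝ) * ℓ (a ^ (k - m) * b ^ m)))
        (∑ m ∈ Finset.range (k + 1), ((m : ℝ) * 0 ^ (m - 1)) *
        ((k.choose m : ℝ) * ℓ (a ^ (k - m) * b ^ m))) 0 := by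
      refine HasDerivAt.fun_sum fun m _ => ?_
      exact (hasDerivAt_pow m (0:ℝ)).mul_const _
    convert this using 1
    rcases Nat.eq_zero_or_pos k with rfl | hk
    · simp
    rw [Finset.sum_eq_single 1]
    · simp
    · intro m _ hm
      rcases m with _ | m
      · simp
      · have : m ≠ 0 := by omega
        simp [this]
    · intro h; simp at h; omega
  have d1 : HasDerivAt (fun τ : ℝ => ℓ ((∑ i, (t + τ • v) i • X i) ^ k))
      (∑ β ∈ Finset.Nat.antidiagonalTuple n k,
        ((k.factorial : ℝ) / ∏ i, ((β i).factorial : ℝ)) *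
          lineDeriv ℝ (fun t : EuclideanSpace ℝ (Fin n) => ∏ i, t i ^ β i) t v *
          ℓ (∏ i, X i ^ β i)) 0 := by
    simp only [h1]
    refine HasDerivAt.fun_sum fun β _ => ?_
    refine HasDerivAt.mul_const (HasDerivAt.const_mul _ ?_) _
    unfold lineDeriv
    apply DifferentiableAt.hasDerivAt
    simp only [PiLp.add_apply, PiLp.smul_apply]
    fun_prop
  exact d2.unique d1

open scoped IsMulCommutative in
lemma alg_noncomm {M : Type*} [Ring M] [Algebra ℝ M] {n : ℕ} (X : Fin n → M)
    (hX : ∀ i j, X i * X j = X j * X i) (ℓ : M →ₗ[ℝ] ℝ)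
    (t v : EuclideanSpace ℝ (Fin n)) (k : ℕ) :
    (k : ℝ) * ℓ ((∑ i, t i • X i) ^ (k - 1) * (∑ i, v i • X i)) =
      ∑ β ∈ Finset.Nat.antidiagonalTuple n k,
        ((k.factorial : ℝ) / ∏ i, ((β i).factorial : ℝ)) *
          lineDeriv ℝ (fun t : EuclideanSpace ℝ (Fin n) => ∏ i, t i ^ β i) t v *
          ℓ (((List.finRange n).map fun i => X i ^ β i).prod) := by
  have hc : IsMulCommutative (Algebra.adjoin ℝ (Set.range X)) := by
    apply Algebra.isMulCommutative_adjoin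
    rintro _ ⟨i, rfl⟩ _ ⟨j, rfl⟩
    exact hX i j
  let Y : Fin n → Algebra.adjoin ℝ (Set.range X) :=
    fun i => ⟨X i, Algebra.subset_adjoin ⟨i, rfl⟩⟩
  have := alg_comm Y (ℓ ∘ₗ (Algebra.adjoin ℝ (Set.range X)).val.toLinearMap) t v k
  have e : ∀ β : Fin n → ℕ, (Algebra.adjoin ℝ (Set.range X)).val (∏ i, Y i ^ β i) =
      ((List.finRange n).map fun i => X i ^ β i).prod := by
    intro β
    rw [← List.prod_ofFn, map_list_prod, List.ofFn_eq_map, List.map_map]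
    rfl
  simp only [LinearMap.comp_apply, AlgHom.toLinearMap_apply, e] at this
  simpa [Y] using this

end Alg

section Ops

open scoped ContDiff

/-- Functions smooth away from the origin. -/
noncomputable def smoothOff (n : ℕ) : Submodule ℝ (EuclideanSpace ℝ (Fin n) → ℝ) where
  carrier := {A | ContDiffOn ℝ ∞ A {0}ᶜ}
  add_mem' := fun ha hb => ContDiffOn.add ha hb
  zero_mem' := contDiffOn_const
  smul_mem' := fun c _ ha => ContDiffOn.const_smul c ha

lemma smoothOff_at {n : ℕ} (A : smoothOff n) {x : EuclideanSpace ℝ (Fin n)} (hx : x ≠ 0) :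
    ContDiffAt ℝ ∞ A.1 x :=
  (A.2 : ContDiffOn ℝ ∞ A.1 {0}ᶜ).contDiffAt (isOpen_compl_singleton.mem_nhds hx)

lemma smoothOff_diff {n : ℕ} (A : smoothOff n) {x : EuclideanSpace ℝ (Fin n)} (hx : x ≠ 0) :
    DifferentiableAt ℝ A.1 x :=
  (smoothOff_at A hx).differentiableAt (by simp)

/-- Directional derivative away from the origin. -/
noncomputable def dOp {n : ℕ} (w : EuclideanSpace ℝ (Fin n)) : Module.End ℝ (smoothOff n) where
  toFun A := ⟨fun x => if x = 0 then 0 else fderiv ℝ A.1 x w, by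
    have h : ContDiffOn ℝ ∞ (fun x => fderiv ℝ A.1 x w) {0}ᶜ := by
      have := (A.2 : ContDiffOn ℝ ∞ A.1 {0}ᶜ).fderiv_of_isOpen (m := ∞)
        isOpen_compl_singleton (by simp)
      exact this.clm_apply contDiffOn_const
    refine ContDiffOn.congr h fun x hx => ?_
    have : x ≠ 0 := hx
    simp [this]⟩
  map_add' A B := by
    ext x
    by_cases hx : x = 0
    · simp [hx]
    · simp [hx, fderiv_add (smoothOff_diff A hx) (smoothOff_diff B hx)]
  map_smul' c A := by
    ext x
    by_cases hx : x = 0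
    · simp [hx]
    · simp [hx, fderiv_const_smul (smoothOff_diff A hx)]

lemma dOp_apply {n : ℕ} (w : EuclideanSpace ℝ (Fin n)) (A : smoothOff n)
    {x : EuclideanSpace ℝ (Fin n)} (hx : x ≠ 0) : (dOp w A).1 x = fderiv ℝ A.1 x w := by
  simp [dOp, hx]

lemma dOp_zero {n : ℕ} (w : EuclideanSpace ℝ (Fin n)) (A : smoothOff n) : (dOp w A).1 0 = 0 := by
  simp [dOp]

lemma dOp_comm {n : ℕ} (u w : EuclideanSpace ℝ (Fin n)) : dOp u * dOp w = dOp w * dOp u := by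
  have key : ∀ (u w : EuclideanSpace ℝ (Fin n)) (A : smoothOff n) (x : EuclideanSpace ℝ (Fin n)),
      x ≠ 0 → (dOp u (dOp w A)).1 x = fderiv ℝ (fderiv ℝ A.1) x u w := by
    intro u w A x hx
    rw [dOp_apply _ _ hx]
    have e : (dOp w A).1 =ᶠ[nhds x] fun y => fderiv ℝ A.1 y w := by
      filter_upwards [isOpen_compl_singleton.mem_nhds hx] with y hy
      exact dOp_apply w A hy
    rw [e.fderiv_eq]
    have hd : DifferentiableAt ℝ (fderiv ℝ A.1) x :=
      ((smoothOff_at A hx).fderiv_right (m := 1) (WithTop.coe_le_coe.2 le_top)).differentiableAt (by simp)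
    rw [fderiv_clm_apply hd (by fun_prop)]
    simp
  ext A x
  by_cases hx : x = 0
  · simp only [Module.End.mul_apply]; rw [hx, dOp_zero, dOp_zero]
  · simp only [Module.End.mul_apply]
    rw [key _ _ _ _ hx, key _ _ _ _ hx]
    exact ((smoothOff_at A hx).isSymmSndFDerivAt (by
      simp only [minSmoothness_of_isRCLikeNormedField]
      exact WithTop.coe_le_coe.2 (le_top : (2 : ℕ∞) ≤ ⊤))) u w

lemma dOp_eq_sum {n : ℕ} (w : EuclideanSpace ℝ (Fin n)) :
    dOp w = ∑ i, w i • dOp (EuclideanSpace.single i (1 : ℝ)) := by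
  have hw : w = ∑ i, w i • EuclideanSpace.single i (1 : ℝ) := by
    ext j; simp [Finset.sum_apply, Pi.single_apply]
  ext A x
  by_cases hx : x = 0
  · simp [hx, dOp]
  · simp only [LinearMap.sum_apply, LinearMap.smul_apply, Submodule.coe_sum, Submodule.coe_smul,
      Finset.sum_apply, Pi.smul_apply]
    simp only [dOp_apply _ _ hx]
    conv_lhs => rw [hw]
    simp

/-- Reflection. -/
noncomputable def negOp (n : ℕ) : Module.End ℝ (smoothOff n) where
  toFun A := ⟨fun x => A.1 (-x), by
    refine ContDiffOn.comp (A.2 : ContDiffOn ℝ ∞ A.1 {0}ᶜ) contDiff_neg.contDiffOn ?_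
    intro x hx; simpa using hx⟩
  map_add' A B := rfl
  map_smul' c A := rfl

lemma negOp_apply {n : ℕ} (A : smoothOff n) (x : EuclideanSpace ℝ (Fin n)) :
    (negOp n A).1 x = A.1 (-x) := rfl

lemma negOp_dOp {n : ℕ} (w : EuclideanSpace ℝ (Fin n)) (A : smoothOff n) :
    negOp n (dOp w A) = - dOp w (negOp n A) := by
  ext x
  by_cases hx : x = 0
  · simp [hx, dOp, negOp]
  · change (dOp w A).1 (-x) = - (dOp w (negOp n A)).1 x
    rw [dOp_apply _ _ hx, dOp_apply _ _ (neg_ne_zero.2 hx)]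
    change _ = - (fderiv ℝ (fun x => A.1 (-x)) x w)
    have hc := (smoothOff_diff A (neg_ne_zero.2 hx)).hasFDerivAt.comp x (hasFDerivAt_id x).neg
    have hc' : fderiv ℝ (fun x => A.1 (-x)) x = _ := hc.fderiv
    rw [hc']
    simp

/-- The operator `D^β` on `smoothOff n`. -/
noncomputable def mOp {n : ℕ} (β : Fin n → ℕ) : Module.End ℝ (smoothOff n) :=
  ((List.finRange n).map fun i => dOp (EuclideanSpace.single i (1 : ℝ)) ^ β i).prod

lemma mOp_comm {n : ℕ} (β : Fin n → ℕ) (w : EuclideanSpace ℝ (Fin n)) :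
    dOp w * mOp β = mOp β * dOp w := by
  refine Commute.list_prod_right _ _ fun y hy => ?_
  obtain ⟨i, -, rfl⟩ := List.mem_map.1 hy
  exact Commute.pow_right (dOp_comm _ _) _

lemma pderiv_eqOn {n : ℕ} (i : Fin n) (F : EuclideanSpace ℝ (Fin n) → ℝ) (A : smoothOff n)
    (h : Set.EqOn F A.1 {0}ᶜ) :
    Set.EqOn (pderiv' i F) (dOp (EuclideanSpace.single i (1 : ℝ)) A).1 {0}ᶜ := by
  intro x hx
  have e : F =ᶠ[nhds x] A.1 := by
    filter_upwards [isOpen_compl_singleton.mem_nhds hx] with y hy using h hy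
  rw [dOp_apply _ _ hx]
  unfold pderiv'
  rw [e.lineDeriv_eq]
  exact (smoothOff_diff A hx).lineDeriv_eq_fderiv

lemma pderiv_iter_eqOn {n : ℕ} (i : Fin n) (m : ℕ) (F : EuclideanSpace ℝ (Fin n) → ℝ)
    (A : smoothOff n) (h : Set.EqOn F A.1 {0}ᶜ) :
    Set.EqOn ((pderiv' i)^[m] F) ((dOp (EuclideanSpace.single i (1 : ℝ)) ^ m) A).1 {0}ᶜ := by
  induction m with
  | zero => simpa using h
  | succ m ih =>
    rw [Function.iterate_succ_apply', pow_succ', Module.End.mul_apply]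
    exact pderiv_eqOn i _ _ ih

lemma multiDeriv_eqOn {n : ℕ} (β : Fin n → ℕ) (A : smoothOff n) :
    Set.EqOn (multiDeriv β A.1) (mOp β A).1 {0}ᶜ := by
  unfold multiDeriv mOp
  induction List.finRange n with
  | nil => intro x _; simp
  | cons i l ih =>
    simp only [List.foldr_cons, List.map_cons, List.prod_cons, Module.End.mul_apply]
    exact pderiv_iter_eqOn i _ _ _ ih

lemma negOp_pow {n : ℕ} (w : EuclideanSpace ℝ (Fin n)) (m : ℕ) (A : smoothOff n) :
    negOp n ((dOp w ^ m) A) = (-1 : ℝ) ^ m • (dOp w ^ m) (negOp n A) := by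
  induction m with
  | zero => simp
  | succ m ih =>
    rw [pow_succ', Module.End.mul_apply, negOp_dOp, ih, map_smul, pow_succ (-1 : ℝ), Module.End.mul_apply]
    ext x
    simp

lemma negOp_mOp {n : ℕ} (β : Fin n → ℕ) (A : smoothOff n) :
    negOp n (mOp β A) = (-1 : ℝ) ^ (∑ i, β i) • mOp β (negOp n A) := by
  unfold mOp
  rw [← List.sum_ofFn, List.ofFn_eq_map]
  induction List.finRange n with
  | nil => simp
  | cons i l ih =>
    simp only [List.map_cons, List.prod_cons, Module.End.mul_apply, List.sum_cons]
    rw [negOp_pow, ih, map_smul, smul_smul, pow_add]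

lemma fundSol_smooth (n : ℕ) : fundSol n ∈ smoothOff n := by
  change ContDiffOn ℝ ∞ _ _
  intro x hx
  have hx' : x ≠ 0 := hx
  have hnorm : ContDiffAt ℝ ∞ (fun x : EuclideanSpace ℝ (Fin n) => ‖x‖) x := contDiffAt_norm ℝ hx'
  apply ContDiffAt.contDiffWithinAt
  unfold fundSol
  by_cases h2 : n = 2
  · simp only [h2, if_true]
    subst h2
    exact contDiffAt_const.mul (hnorm.log (norm_ne_zero_iff.2 hx'))
  · simp only [h2, if_false]
    exact contDiffAt_const.mul (hnorm.rpow_const_of_ne (norm_ne_zero_iff.2 hx'))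

/-- The fundamental solution as an element of `smoothOff n`. -/
noncomputable def GG (n : ℕ) : smoothOff n := ⟨fundSol n, fundSol_smooth n⟩

lemma negOp_GG (n : ℕ) : negOp n (GG n) = GG n := by
  ext x
  change fundSol n (-x) = fundSol n x
  simp [fundSol]

lemma inner_gradient' {n : ℕ} (F : EuclideanSpace ℝ (Fin n) → ℝ) (A : smoothOff n)
    (h : Set.EqOn F A.1 {0}ᶜ) (z x : EuclideanSpace ℝ (Fin n)) (hx : x ≠ 0) :
    ⟪z, gradient F x⟫ = ∑ i, (dOp (EuclideanSpace.single i (1 : ℝ)) A).1 x * z i := by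
  have e : F =ᶠ[nhds x] A.1 := by
    filter_upwards [isOpen_compl_singleton.mem_nhds hx] with y hy using h hy
  have h1 : ⟪z, gradient F x⟫ = (dOp z A).1 x := by
    rw [dOp_apply _ _ hx, real_inner_comm, gradient, InnerProductSpace.toDual_symm_apply,
      e.fderiv_eq]
  rw [h1, dOp_eq_sum z]
  simp only [LinearMap.sum_apply, LinearMap.smul_apply, Submodule.coe_sum, Submodule.coe_smul,
      Finset.sum_apply, Pi.smul_apply, smul_eq_mul, mul_comm]

end Ops

section Ana

open scoped ContDiff

/-- The potential with kernel `A` and density `m`. -/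
noncomputable def pot {n : ℕ} (σ : Measure (EuclideanSpace ℝ (Fin n)))
    (A : smoothOff n) (m : EuclideanSpace ℝ (Fin n) → ℝ) (s : EuclideanSpace ℝ (Fin n)) : ℝ :=
  ∫ y, A.1 (s - y) * m y ∂σ

variable {n : ℕ} {σ : Measure (EuclideanSpace ℝ (Fin n))} {S : Set (EuclideanSpace ℝ (Fin n))}
  {r : ℝ} {m : EuclideanSpace ℝ (Fin n) → ℝ}

lemma sub_ne_of_lt (hr : ∀ y ∈ S, r ≤ ‖y‖) {s y : EuclideanSpace ℝ (Fin n)} (hs : ‖s‖ < r)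
    (hy : y ∈ S) : s - y ≠ 0 := by
  intro h
  rw [sub_eq_zero] at h
  have := hr y hy
  rw [← h] at this
  linarith

lemma kernel_cont (hr : ∀ y ∈ S, r ≤ ‖y‖) (hm : Continuous m) (A : smoothOff n) :
    ContinuousOn (fun q : EuclideanSpace ℝ (Fin n) × EuclideanSpace ℝ (Fin n) =>
      A.1 (q.1 - q.2) * m q.2) (Metric.ball 0 r ×ˢ S) := by
  refine ContinuousOn.mul ?_ (by fun_prop)
  refine (A.2 : ContDiffOn ℝ ∞ A.1 {0}ᶜ).continuousOn.comp (by fun_prop) ?_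
  rintro ⟨s, y⟩ ⟨hs, hy⟩
  exact sub_ne_of_lt hr (by simpa using hs) hy

lemma kernel_int [IsFiniteMeasure σ] (hS : IsCompact S) (hσ : σ.restrict S = σ)
    (hr : ∀ y ∈ S, r ≤ ‖y‖) (hm : Continuous m) (A : smoothOff n)
    {s : EuclideanSpace ℝ (Fin n)} (hs : ‖s‖ < r) :
    Integrable (fun y => A.1 (s - y) * m y) σ := by
  have : ContinuousOn (fun y => A.1 (s - y) * m y) S := by
    refine (kernel_cont hr hm A).comp (f := fun y => (s, y)) (by fun_prop) ?_
    intro y hy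
    exact ⟨by simpa using hs, hy⟩
  have h2 : IntegrableOn (fun y => A.1 (s - y) * m y) S σ := this.integrableOn_compact hS
  rwa [IntegrableOn, hσ] at h2

lemma pot_hasDerivAt [IsFiniteMeasure σ] (hS : IsCompact S) (hσ : σ.restrict S = σ)
    (hr : ∀ y ∈ S, r ≤ ‖y‖) (hm : Continuous m) (A : smoothOff n)
    (p w : EuclideanSpace ℝ (Fin n)) (τ₀ : ℝ) (hs : ‖p + τ₀ • w‖ < r) :
    HasDerivAt (fun τ : ℝ => pot σ A m (p + τ • w)) (pot σ (dOp w A) m (p + τ₀ • w)) τ₀ := by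
  obtain ⟨ρ, h1, h2⟩ := exists_between hs
  have hK : IsCompact (Metric.closedBall (0 : EuclideanSpace ℝ (Fin n)) ρ ×ˢ S) :=
    (isCompact_closedBall _ _).prod hS
  obtain ⟨C, hC⟩ := hK.exists_bound_of_continuousOn ((kernel_cont hr hm (dOp w A)).mono
    (Set.prod_mono_left (Metric.closedBall_subset_ball h2)))
  have hae : ∀ᵐ y ∂σ, y ∈ S := by
    rw [← hσ]; exact ae_restrict_mem hS.measurableSet
  have hcont : Continuous fun τ : ℝ => ‖p + τ • w‖ := by fun_prop
  refine (hasDerivAt_integral_of_dominated_loc_of_deriv_le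
    (F := fun τ y => A.1 (p + τ • w - y) * m y)
    (F' := fun τ y => (dOp w A).1 (p + τ • w - y) * m y)
    (s := {τ : ℝ | ‖p + τ • w‖ < ρ}) (bound := fun _ => C) ?_ ?_ ?_ ?_ ?_ ?_ ?_).2
  · exact (isOpen_lt hcont continuous_const).mem_nhds h1
  · filter_upwards [(isOpen_lt hcont continuous_const).mem_nhds hs] with τ hτ
    exact (kernel_int hS hσ hr hm A hτ).aestronglyMeasurable
  · exact kernel_int hS hσ hr hm A hs
  · exact (kernel_int hS hσ hr hm _ hs).aestronglyMeasurable
  · filter_upwards [hae] with y hy τ hτ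
    exact hC (p + τ • w, y) ⟨by simpa using (le_of_lt hτ : ‖p + τ • w‖ ≤ ρ), hy⟩
  · exact integrable_const _
  · filter_upwards [hae] with y hy τ hτ
    have hne : p + τ • w - y ≠ 0 := sub_ne_of_lt hr (lt_trans hτ h2) hy
    refine HasDerivAt.mul_const ?_ _
    rw [dOp_apply _ _ hne]
    have hl : HasDerivAt (fun τ : ℝ => p + τ • w - y) w τ := by
      simpa using (((hasDerivAt_id τ).smul_const w).const_add p).sub_const y
    exact (smoothOff_diff A hne).hasFDerivAt.comp_hasDerivAt τ hl

/-- Linear functional `P ↦ pot (P A) m 0`. -/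
noncomputable def potFun [IsFiniteMeasure σ] (hS : IsCompact S) (hσ : σ.restrict S = σ)
    (hr0 : 0 < r) (hr : ∀ y ∈ S, r ≤ ‖y‖) (hm : Continuous m) (A : smoothOff n) :
    Module.End ℝ (smoothOff n) →ₗ[ℝ] ℝ where
  toFun P := pot σ (P A) m 0
  map_add' P Q := by
    have h : ‖(0 : EuclideanSpace ℝ (Fin n))‖ < r := by simpa
    unfold pot
    rw [← integral_add (kernel_int hS hσ hr hm _ h) (kernel_int hS hσ hr hm _ h)]
    simp [add_mul]
  map_smul' c P := by
    unfold pot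
    simp [mul_assoc, integral_const_mul]

lemma iter_deriv [IsFiniteMeasure σ] (hS : IsCompact S) (hσ : σ.restrict S = σ)
    (hr : ∀ y ∈ S, r ≤ ‖y‖) (mm : Fin n → EuclideanSpace ℝ (Fin n) → ℝ)
    (hm : ∀ i, Continuous (mm i)) (B : Fin n → smoothOff n)
    (t : EuclideanSpace ℝ (Fin n)) (F : ℝ → ℝ)
    (hF : ∀ ε : ℝ, ‖ε • t‖ < r → F ε = -∑ i, ε * pot σ (B i) (mm i) (ε • t)) (k : ℕ) :
    ∀ ε : ℝ, ‖ε • t‖ < r → iteratedDeriv k F ε =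
      -∑ i, (ε * pot σ ((dOp t ^ k) (B i)) (mm i) (ε • t) +
        k * pot σ ((dOp t ^ (k - 1)) (B i)) (mm i) (ε • t)) := by
  induction k with
  | zero => intro ε hε; simpa using hF ε hε
  | succ k ih =>
    intro ε hε
    rw [iteratedDeriv_succ]
    have hcont : Continuous fun τ : ℝ => ‖τ • t‖ := by fun_prop
    have e : iteratedDeriv k F =ᶠ[nhds ε] fun ε => -∑ i,
        (ε * pot σ ((dOp t ^ k) (B i)) (mm i) (ε • t) +
        k * pot σ ((dOp t ^ (k - 1)) (B i)) (mm i) (ε • t)) := by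
      filter_upwards [(isOpen_lt hcont continuous_const).mem_nhds hε] with τ hτ using ih τ hτ
    rw [e.deriv_eq]
    have hd : ∀ (j : ℕ) (i : Fin n), HasDerivAt
        (fun τ : ℝ => pot σ ((dOp t ^ j) (B i)) (mm i) (τ • t))
        (pot σ ((dOp t ^ (j + 1)) (B i)) (mm i) (ε • t)) ε := by
      intro j i
      have := pot_hasDerivAt hS hσ hr (hm i) ((dOp t ^ j) (B i)) 0 t ε (by simpa using hε)
      simpa [pow_succ'] using this
    apply HasDerivAt.deriv
    refine HasDerivAt.fun_neg (HasDerivAt.fun_sum fun i _ => ?_)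
    have h1 := (hasDerivAt_id ε).fun_mul (hd k i)
    have h2 := (hd (k - 1) i).const_mul (k : ℝ)
    refine (h1.fun_add h2).congr_deriv ?_
    rcases k with _ | k
    · simp; ring
    · simp; ring

end Ana

/-- Let `F(ε) = -v · ∇_t [t ↦ ∫_{∂Ωᵒ} ν(y) · ∇G_n(ε•t - y) θ(y) dσ(y)](t₀)`. Then the `k`-th
derivative of `F` at `ε = 0` equals
`(-1)^k ∑_{|β|=k} (k!/β!) (v · ∇p_β(t₀)) ∫_{∂Ωᵒ} ν(y) · (∇D^β G_n)(y) θ(y) dσ(y)`, where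
`p_β(t) = t^β`. -/
theorem stmt14 (n : ℕ) (hn : 2 ≤ n) (Ωo : Set (EuclideanSpace ℝ (Fin n)))
    (hΩ : IsOpen Ωo) (hb : Bornology.IsBounded Ωo) (h0 : (0 : EuclideanSpace ℝ (Fin n)) ∈ Ωo)
    (hfin : IsFiniteMeasure (bdryMeasure n (frontier Ωo)))
    (ν : EuclideanSpace ℝ (Fin n) → EuclideanSpace ℝ (Fin n)) (hν : Continuous ν)
    (θ : EuclideanSpace ℝ (Fin n) → ℝ) (hθ : Continuous θ)
    (v : EuclideanSpace ℝ (Fin n))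
    (t₀ : EuclideanSpace ℝ (Fin n)) (k : ℕ) :
    iteratedDeriv k
        (fun ε : ℝ =>
          -lineDeriv ℝ
            (fun t => ∫ y, ⟪ν y, gradient (fundSol n) (ε • t - y)⟫ * θ y
              ∂(bdryMeasure n (frontier Ωo))) t₀ v) 0 =
      (-1 : ℝ) ^ k * ∑ β ∈ Finset.Nat.antidiagonalTuple n k,
        ((k.factorial : ℝ) / ∏ i, ((β i).factorial : ℝ)) *
          lineDeriv ℝ (fun t : EuclideanSpace ℝ (Fin n) => ∏ i, t i ^ β i) t₀ v *
          ∫ y, ⟪ν y, gradient (multiDeriv β (fundSol n)) y⟫ * θ y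
            ∂(bdryMeasure n (frontier Ωo)) := by

  set σ := bdryMeasure n (frontier Ωo) with hσdef
  have hS : IsCompact (frontier Ωo) :=
    Metric.isCompact_of_isClosed_isBounded isClosed_frontier (hb.closure.subset frontier_subset_closure)
  have hσ : σ.restrict (frontier Ωo) = σ := by
    rw [hσdef, bdryMeasure, Measure.restrict_restrict hS.measurableSet, Set.inter_self]
  have hae : ∀ᵐ y ∂σ, y ∈ frontier Ωo := by
    rw [← hσ]; exact ae_restrict_mem hS.measurableSet
  obtain ⟨r, hr0, hball⟩ := Metric.isOpen_iff.1 hΩ 0 h0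
  have hr : ∀ y ∈ frontier Ωo, r ≤ ‖y‖ := by
    intro y hy
    by_contra hlt
    have h1 : y ∈ Ωo := hball (by simpa using hlt)
    rw [hΩ.frontier_eq] at hy
    exact hy.2 h1
  let e : Fin n → EuclideanSpace ℝ (Fin n) := fun i => EuclideanSpace.single i (1 : ℝ)
  let mm : Fin n → EuclideanSpace ℝ (Fin n) → ℝ := fun i y => ν y i * θ y
  have hm : ∀ i, Continuous (mm i) := by
    intro i; simp only [mm]; fun_prop
  -- the inner integral
  let h : EuclideanSpace ℝ (Fin n) → ℝ := fun s => ∫ y, ⟪ν y, gradient (fundSol n) (s - y)⟫ * θ y ∂σ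
  have hpot : ∀ s, ‖s‖ < r → h s = ∑ i, pot σ (dOp (e i) (GG n)) (mm i) s := by
    intro s hs
    simp only [h, pot]
    rw [← integral_finsetSum _ fun i _ => kernel_int hS hσ hr (hm i) _ hs]
    refine integral_congr_ae ?_
    filter_upwards [hae] with y hy
    rw [inner_gradient' (fundSol n) (GG n) (fun x _ => rfl) _ _ (sub_ne_of_lt hr hs hy),
      Finset.sum_mul]
    simp only [mm, e, mul_assoc]
  have hline : ∀ s, ‖s‖ < r → lineDeriv ℝ h s v =
      ∑ i, pot σ (dOp v (dOp (e i) (GG n))) (mm i) s := by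
    intro s hs
    have hcont : Continuous fun τ : ℝ => ‖s + τ • v‖ := by fun_prop
    have ee : (fun τ : ℝ => h (s + τ • v)) =ᶠ[nhds 0] fun τ =>
        ∑ i, pot σ (dOp (e i) (GG n)) (mm i) (s + τ • v) := by
      filter_upwards [(isOpen_lt hcont continuous_const).mem_nhds
        (show ‖s + (0:ℝ) • v‖ < r by simpa using hs)] with τ hτ using hpot _ hτ
    rw [lineDeriv, ee.deriv_eq]
    refine HasDerivAt.deriv (HasDerivAt.fun_sum fun i _ => ?_)
    simpa using pot_hasDerivAt hS hσ hr (hm i) (dOp (e i) (GG n)) s v 0 (by simpa using hs)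
  have hF : ∀ ε : ℝ, ‖ε • t₀‖ < r →
      -lineDeriv ℝ (fun t => ∫ y, ⟪ν y, gradient (fundSol n) (ε • t - y)⟫ * θ y ∂σ) t₀ v =
      -∑ i, ε * pot σ (dOp v (dOp (e i) (GG n))) (mm i) (ε • t₀) := by
    intro ε hε
    rw [← Finset.mul_sum, ← hline _ hε]
    congr 1
    rw [← smul_eq_mul, ← lineDeriv_smul]
    simp only [lineDeriv, h, smul_add]
    congr 1
    funext τ
    rw [smul_comm ε τ v]
  rw [iter_deriv hS hσ hr mm hm (fun i => dOp v (dOp (e i) (GG n))) t₀ _ hF k 0 (by simpa using hr0)]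
  have hR : ∀ β ∈ Finset.Nat.antidiagonalTuple n k,
      ∫ y, ⟪ν y, gradient (multiDeriv β (fundSol n)) y⟫ * θ y ∂σ =
      (-1 : ℝ) ^ (k + 1) * ∑ i, pot σ (mOp β (dOp (e i) (GG n))) (mm i) 0 := by
    intro β hβ
    have hs : ∑ i, β i = k := Finset.Nat.mem_antidiagonalTuple.1 hβ
    have h00 : ‖(0 : EuclideanSpace ℝ (Fin n))‖ < r := by simpa using hr0
    simp only [pot]
    rw [← integral_finsetSum _ fun i _ => kernel_int hS hσ hr (hm i) _ h00, ← integral_const_mul]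
    refine integral_congr_ae ?_
    filter_upwards [hae] with y hy
    have hy0 : y ≠ 0 := by
      rintro rfl
      have := hr _ hy
      simp at this; linarith
    rw [inner_gradient' (multiDeriv β (fundSol n)) (mOp β (GG n)) (multiDeriv_eqOn β (GG n)) _ _ hy0,
      Finset.sum_mul, Finset.mul_sum]
    refine Finset.sum_congr rfl fun i _ => ?_
    have hc : dOp (e i) (mOp β (GG n)) = mOp β (dOp (e i) (GG n)) :=
      LinearMap.congr_fun (mOp_comm β (e i)) (GG n)
    have hneg : negOp n (mOp β (dOp (e i) (GG n))) =
        (-1 : ℝ) ^ k • mOp β (-(dOp (e i) (GG n))) := by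
      rw [negOp_mOp, hs, negOp_dOp, negOp_GG]
    have hval : (mOp β (dOp (e i) (GG n))).1 (0 - y) =
        (-1 : ℝ) ^ (k + 1) * (dOp (e i) (mOp β (GG n))).1 y := by
      rw [zero_sub, ← negOp_apply, hneg, hc, map_neg]
      simp [pow_succ]
    change (dOp (e i) (mOp β (GG n))).1 y * ν y i * θ y = _
    rw [hval]
    have h1 : ((-1 : ℝ) ^ (k + 1)) * (-1 : ℝ) ^ (k + 1) = 1 := by
      rw [← mul_pow]; simp
    simp only [mm]
    linear_combination (-(dOp (e i) (mOp β (GG n))).1 y * ν y i * θ y) * h1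
  have halg : ∀ i, (k : ℝ) * pot σ ((dOp t₀ ^ (k - 1)) (dOp v (dOp (e i) (GG n)))) (mm i) 0 =
      ∑ β ∈ Finset.Nat.antidiagonalTuple n k,
        ((k.factorial : ℝ) / ∏ i, ((β i).factorial : ℝ)) *
          lineDeriv ℝ (fun t : EuclideanSpace ℝ (Fin n) => ∏ i, t i ^ β i) t₀ v *
          pot σ (mOp β (dOp (e i) (GG n))) (mm i) 0 := by
    intro i
    have := alg_noncomm (fun j => dOp (EuclideanSpace.single j (1 : ℝ))) (fun _ _ => dOp_comm _ _)
      (potFun hS hσ hr0 hr (hm i) (dOp (e i) (GG n))) t₀ v k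
    rw [← dOp_eq_sum, ← dOp_eq_sum] at this
    exact this
  simp only [zero_mul, zero_add, zero_smul]
  rw [Finset.sum_congr rfl fun i _ => halg i, Finset.sum_comm, Finset.mul_sum,
    ← Finset.sum_neg_distrib]
  refine Finset.sum_congr rfl fun β hβ => ?_
  rw [hR β hβ, ← Finset.mul_sum]
  have h1 : ((-1 : ℝ) ^ k) * (-1 : ℝ) ^ k = 1 := by
    rw [← mul_pow]; simp
  rw [pow_succ]
  linear_combination ((k.factorial : ℝ) / ∏ i, ((β i).factorial : ℝ)) *
          lineDeriv ℝ (fun t : EuclideanSpace ℝ (Fin n) => ∏ i, t i ^ β i) t₀ v *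
          (∑ i, pot σ (mOp β (dOp (e i) (GG n))) (mm i) 0) * h1
end
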